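/- Let (σ_η², ν_η, γ_η) ≠ (0, 0, 0) and (σ_Ũ², ν_Ũ, γ_Ũ) be Lévy triplets with ν_Ũ concentrated on [−1,∞), let μ be an invariant probability measure for the generator A, and assume σ_η² = σ_Ũ² = 0, ∫_{[−1,1]} |y| ν_η(dy) < ∞ and ∫_{[−1,1]} |y| ν_Ũ(dy) < ∞. Set γ_η⁰ = γ_η − ∫_{[−1,1]} y ν_η(dy) and γ_Ũ⁰ = γ_Ũ − ∫_{[−1,1]} y ν_Ũ(dy). Then for every continuous compactly supported g: ℝ → ℝ, 0 = ∫ g(z) (γ_η⁰ + z γ_Ũ⁰) μ(dz) + ∫ g(z) (B_η^{FV}∗μ)(z) dz + ∫ g(z) [ 1_{z>0} ∫_{(0,∞)} B_Ũ^{FV}(z/x) μ(dx) − 1_{z<0} ∫_{(−∞,0)} B_Ũ^{FV}(z/x) μ(dx) ] dz, and the quantities appearing define a locally finite signed measure. -/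

import Mathlib

open MeasureTheory Set Filter

noncomputable section

namespace KEF

def IsLevyMeasure (ν : Measure ℝ) : Prop :=
  ν {0} = 0 ∧ ∫⁻ y, ENNReal.ofReal (min 1 (y ^ 2)) ∂ν < ⊤

/-- The generator `A` of the killed generalized OU process, expressed through the
Lévy triplets `(ση2, νη, γη)` of `η` and `(σU2, νU, γU)` of `Ũ`. -/
def levyGen (ση2 γη σU2 γU : ℝ) (νη νU : Measure ℝ) (f : ℝ → ℝ) (x : ℝ) : ℝ :=
  γη * deriv f x + ση2 / 2 * deriv (deriv f) x
    + (∫ y, (f (x + y) - f x - (if |y| ≤ 1 then y * deriv f x else 0)) ∂νη)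
    + γU * (x * deriv f x) + σU2 / 2 * (x ^ 2 * deriv (deriv f) x)
    + ∫ y in Ici (-1 : ℝ), (f (x + x * y) - f x - (if |y| ≤ 1 then x * y * deriv f x else 0)) ∂νU

/-- `μ` is invariant for the generator: `∫ Af dμ = 0` for all test functions `f`. -/
def Invariant (ση2 γη σU2 γU : ℝ) (νη νU : Measure ℝ) (μ : Measure ℝ) : Prop :=
  ∀ f : ℝ → ℝ, ContDiff ℝ (⊤ : ℕ∞) f → HasCompactSupport f →
    ∫ x, levyGen ση2 γη σU2 γU νη νU f x ∂μ = 0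

def Bmap (ν : Measure ℝ) (z : ℝ) : ℝ :=
  if 0 < z then (ν (Ioi (max z 1))).toReal
  else if z < 0 then -((ν (Iio (min z (-1)))).toReal)
  else 0

def BUmap (ν : Measure ℝ) (z : ℝ) : ℝ :=
  if 1 < z then (ν (Ioi (max (z - 1) 1))).toReal else 0

def Smap (ν : Measure ℝ) (z : ℝ) : ℝ :=
  if 0 < z then ∫ y in Ici z ∩ Icc (-1 : ℝ) 1, (y - z) ∂ν
  else if z < 0 then ∫ y in Iic z ∩ Icc (-1 : ℝ) 1, (z - y) ∂ν
  else 0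

def SUmap (ν : Measure ℝ) (z : ℝ) : ℝ :=
  if 0 ≤ z ∧ z < 1 then ∫ y in Icc (-1 : ℝ) (z - 1), (z - 1 - y) ∂ν
  else if 1 < z then ∫ y in Ici (z - 1) ∩ Icc (-1 : ℝ) 1, (y - z + 1) ∂ν
  else 0

/-- convolution of a function with a measure -/
def convM (g : ℝ → ℝ) (μ : Measure ℝ) (z : ℝ) : ℝ := ∫ x, g (z - x) ∂μ

def rmu (νU : Measure ℝ) (μ : Measure ℝ) (z : ℝ) : ℝ :=
  if 0 < z then ∫ x in Ioi (0 : ℝ), x * SUmap νU (z / x) ∂μ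
  else if z < 0 then ∫ x in Iio (0 : ℝ), |x| * SUmap νU (z / x) ∂μ
  else 0

def kmu (νU : Measure ℝ) (μ : Measure ℝ) (t : ℝ) : ℝ :=
  if 0 < t then ∫ x in Ioc (0 : ℝ) t, BUmap νU (t / x) ∂μ
  else if t < 0 then -∫ x in Ico t (0 : ℝ), BUmap νU (t / x) ∂μ
  else 0

def Dmu (γη γU : ℝ) (μ : Measure ℝ) (z : ℝ) : ℝ :=
  if 0 ≤ z then ∫ x in Ioc (0 : ℝ) z, (γη + x * γU) ∂μ
  else -∫ x in Ioc z (0 : ℝ), (γη + x * γU) ∂μ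

end KEF

open KEF



/-- finite variation versions of the functions `B` -/
def BmapFV (ν : Measure ℝ) (z : ℝ) : ℝ :=
  if 0 < z then (ν (Ioi z)).toReal
  else if z < 0 then -((ν (Iio z)).toReal)
  else 0

def BUmapFV (ν : Measure ℝ) (z : ℝ) : ℝ :=
  if 0 ≤ z ∧ z < 1 then -((ν (Iio (z - 1))).toReal)
  else if 1 < z then (ν (Ioi (z - 1))).toReal
  else 0

def kFV (νU : Measure ℝ) (μ : Measure ℝ) (z : ℝ) : ℝ :=
  (if 0 < z then ∫ x in Ioi (0 : ℝ), BUmapFV νU (z / x) ∂μ else 0)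
    - (if z < 0 then ∫ x in Iio (0 : ℝ), BUmapFV νU (z / x) ∂μ else 0)

/-- The signed indicator of the open interval between `a` and `b`: it is `1` on `(a, b)` if
`a < b` and `-1` on `(b, a)` if `b < a`. -/
def crossing (a b z : ℝ) : ℝ :=
  (Ioo a b).indicator 1 z - (Ioo b a).indicator 1 z

/-- A family of jumps from `a ω` to `b ω` whose overlap with `[-R, R]` has length at most
`R * w ω`, for an integrable weight `w`. -/
structure ControlledJumps {Ω : Type*} [MeasurableSpace Ω] (ρ : Measure Ω) (a b w : Ω → ℝ) :
    Prop where
  measurable_left : Measurable a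
  measurable_right : Measurable b
  integrable_weight : Integrable w ρ
  length_le : ∀ R : ℝ, 1 ≤ R → ∀ ω, volume.real (uIoc (a ω) (b ω) ∩ Icc (-R) R) ≤ R * w ω

lemma exists_subset_Icc_neg_of_isCompact {K : Set ℝ} (hK : IsCompact K) :
    ∃ R : ℝ, 1 ≤ R ∧ K ⊆ Icc (-R) R := by
  obtain ⟨R, hR⟩ := hK.isBounded.subset_closedBall (0 : ℝ)
  refine ⟨max R 1, le_max_right R 1, fun z hz => abs_le.1 ?_⟩
  have := mem_closedBall_zero_iff.1 (hR hz)
  exact this.trans (le_max_left R 1)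

lemma intervalIntegral_eq_integral_mul_crossing {g : ℝ → ℝ} (hg : Integrable g) (a b : ℝ) :
    ∫ z in a..b, g z = ∫ z, g z * crossing a b z := by
  have key : ∀ c d : ℝ, ∫ z in Ioc c d, g z = ∫ z, g z * (Ioo c d).indicator 1 z := by
    intro c d
    rw [integral_Ioc_eq_integral_Ioo, ← integral_indicator measurableSet_Ioo]
    congr 1 with z
    by_cases hz : z ∈ Ioo c d <;> simp [hz]
  have hi : ∀ c d : ℝ, Integrable (fun z => g z * (Ioo c d).indicator 1 z) := by
    intro c d
    refine (hg.indicator (measurableSet_Ioo (a := c) (b := d))).congr (ae_of_all _ fun z => ?_)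
    by_cases hz : z ∈ Ioo c d <;> simp [hz]
  simp only [intervalIntegral, crossing, mul_sub]
  rw [integral_sub (hi a b) (hi b a), key, key]

lemma abs_crossing_le (a b z : ℝ) : |crossing a b z| ≤ (uIoc a b).indicator 1 z := by
  unfold crossing
  by_cases h1 : z ∈ Ioo a b
  · have h2 : z ∉ Ioo b a := fun h => by linarith [h1.1, h1.2, h.1, h.2]
    have h3 : z ∈ uIoc a b := mem_uIoc.2 (Or.inl ⟨h1.1, h1.2.le⟩)
    simp [h1, h2, h3]
  · by_cases h2 : z ∈ Ioo b a
    · have h3 : z ∈ uIoc a b := mem_uIoc.2 (Or.inr ⟨h2.1, h2.2.le⟩)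
      simp [h1, h2, h3]
    · simp only [h1, h2, not_false_eq_true, indicator_of_notMem, sub_self, abs_zero]
      exact indicator_nonneg (fun _ _ => zero_le_one) _

lemma abs_intervalIntegral_le {g : ℝ → ℝ} {M R : ℝ} (hM : ∀ z, |g z| ≤ M)
    (hR : ∀ z, g z ≠ 0 → z ∈ Icc (-R) R) (a b : ℝ) :
    |∫ z in a..b, g z| ≤ M * volume.real (uIoc a b ∩ Icc (-R) R) := by
  rw [← Real.norm_eq_abs, intervalIntegral.norm_integral_eq_norm_integral_uIoc]
  have : ∫ z in uIoc a b, g z = ∫ z in uIoc a b ∩ Icc (-R) R, g z := by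
    refine setIntegral_eq_of_subset_of_forall_sdiff_eq_zero measurableSet_uIoc
      inter_subset_left fun z hz => ?_
    by_contra h
    exact hz.2 ⟨hz.1, hR z h⟩
  rw [this]
  exact norm_setIntegral_le_of_norm_le_const
    ((measure_mono inter_subset_right).trans_lt measure_Icc_lt_top) fun z _ => hM z

lemma measurable_crossing {Ω : Type*} [MeasurableSpace Ω] {a b : Ω → ℝ} (ha : Measurable a)
    (hb : Measurable b) : Measurable fun p : Ω × ℝ => crossing (a p.1) (b p.1) p.2 := by
  have key : ∀ {c d : Ω → ℝ}, Measurable c → Measurable d →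
      Measurable fun p : Ω × ℝ => (Ioo (c p.1) (d p.1)).indicator (1 : ℝ → ℝ) p.2 := by
    intro c d hc hd
    have hs : MeasurableSet {p : Ω × ℝ | c p.1 < p.2 ∧ p.2 < d p.1} :=
      (measurableSet_lt (hc.comp measurable_fst) measurable_snd).inter
        (measurableSet_lt measurable_snd (hd.comp measurable_fst))
    exact (measurable_const (a := (1 : ℝ))).indicator hs
  exact (key ha hb).sub (key hb ha)

namespace ControlledJumps

variable {Ω : Type*} [MeasurableSpace Ω] {ρ : Measure Ω} {a b w : Ω → ℝ}

lemma abs_intervalIntegral_le (h : ControlledJumps ρ a b w) {g : ℝ → ℝ} {M R : ℝ}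
    (hR1 : 1 ≤ R) (hM : ∀ z, |g z| ≤ M) (hR : ∀ z, g z ≠ 0 → z ∈ Icc (-R) R) (ω : Ω) :
    |∫ z in a ω..b ω, g z| ≤ M * R * w ω := by
  refine (_root_.abs_intervalIntegral_le hM hR _ _).trans ?_
  rw [mul_assoc]
  exact mul_le_mul_of_nonneg_left (h.length_le R hR1 ω) ((abs_nonneg _).trans (hM 0))

lemma measurable_intervalIntegral (h : ControlledJumps ρ a b w) {g : ℝ → ℝ}
    (hg : Continuous g) : Measurable fun ω => ∫ z in a ω..b ω, g z := by
  have hG : Continuous fun t => ∫ z in (0 : ℝ)..t, g z :=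
    intervalIntegral.continuous_primitive (fun _ _ => hg.intervalIntegrable _ _) 0
  have : (fun ω => ∫ z in a ω..b ω, g z)
      = fun ω => (∫ z in (0 : ℝ)..b ω, g z) - ∫ z in (0 : ℝ)..a ω, g z := by
    ext ω
    rw [intervalIntegral.integral_interval_sub_left (hg.intervalIntegrable _ _)
      (hg.intervalIntegrable _ _)]
  rw [this]
  exact (hG.measurable.comp h.measurable_right).sub (hG.measurable.comp h.measurable_left)

lemma integrable_intervalIntegral (h : ControlledJumps ρ a b w) {g : ℝ → ℝ}
    (hg : Continuous g) {M R : ℝ} (hR1 : 1 ≤ R) (hM : ∀ z, |g z| ≤ M)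
    (hR : ∀ z, g z ≠ 0 → z ∈ Icc (-R) R) :
    Integrable (fun ω => ∫ z in a ω..b ω, g z) ρ :=
  (h.integrable_weight.const_mul (M * R)).mono'
    (h.measurable_intervalIntegral hg).aestronglyMeasurable
    (ae_of_all _ (h.abs_intervalIntegral_le hR1 hM hR))

lemma abs_integral_intervalIntegral_le (h : ControlledJumps ρ a b w) {g : ℝ → ℝ}
    {M R : ℝ} (hR1 : 1 ≤ R) (hM : ∀ z, |g z| ≤ M)
    (hR : ∀ z, g z ≠ 0 → z ∈ Icc (-R) R) :
    |∫ ω, (∫ z in a ω..b ω, g z) ∂ρ| ≤ M * (R * ∫ ω, w ω ∂ρ) := by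
  rw [← mul_assoc, ← integral_const_mul, ← Real.norm_eq_abs]
  exact norm_integral_le_of_norm_le (h.integrable_weight.const_mul (M * R))
    (ae_of_all _ (h.abs_intervalIntegral_le hR1 hM hR))

lemma integrable_crossing [SFinite ρ] (h : ControlledJumps ρ a b w) {R : ℝ} (hR : 1 ≤ R) :
    Integrable (fun p : Ω × ℝ => crossing (a p.1) (b p.1) p.2)
      (ρ.prod (volume.restrict (Icc (-R) R))) := by
  have hm := measurable_crossing h.measurable_left h.measurable_right
  have hslice : ∀ ω, Integrable (fun z => (uIoc (a ω) (b ω)).indicator (1 : ℝ → ℝ) z)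
      (volume.restrict (Icc (-R) R)) := fun ω =>
    (integrable_const (1 : ℝ)).indicator measurableSet_uIoc
  have hint : ∀ ω, Integrable (fun z => crossing (a ω) (b ω) z)
      (volume.restrict (Icc (-R) R)) := fun ω =>
    (hslice ω).mono' (hm.comp measurable_prodMk_left).aestronglyMeasurable
      (ae_of_all _ fun z => abs_crossing_le _ _ z)
  rw [integrable_prod_iff hm.aestronglyMeasurable]
  refine ⟨ae_of_all _ hint, (h.integrable_weight.const_mul R).mono'
    hm.aestronglyMeasurable.norm.integral_prod_right' (ae_of_all _ fun ω => ?_)⟩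
  rw [Real.norm_of_nonneg (integral_nonneg fun _ => norm_nonneg _)]
  refine le_trans ?_ (h.length_le R hR ω)
  refine (integral_mono (hint ω).norm (hslice ω) fun z => abs_crossing_le _ _ z).trans_eq ?_
  rw [integral_indicator_one measurableSet_uIoc, measureReal_restrict_apply measurableSet_uIoc]

lemma locallyIntegrable_integral_crossing [SFinite ρ] (h : ControlledJumps ρ a b w) :
    LocallyIntegrable fun z => ∫ ω, crossing (a ω) (b ω) z ∂ρ := by
  rw [locallyIntegrable_iff]
  intro K hK
  obtain ⟨R, hR, hsub⟩ := exists_subset_Icc_neg_of_isCompact hK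
  exact IntegrableOn.mono_set (h.integrable_crossing hR).integral_prod_right hsub

lemma integral_mul_integral_crossing [SFinite ρ] (h : ControlledJumps ρ a b w) {g : ℝ → ℝ}
    (hg : Continuous g) {M R : ℝ} (hR1 : 1 ≤ R) (hM : ∀ z, |g z| ≤ M)
    (hR : ∀ z, g z ≠ 0 → z ∈ Icc (-R) R) :
    ∫ z, g z * ∫ ω, crossing (a ω) (b ω) z ∂ρ = ∫ ω, (∫ z in a ω..b ω, g z) ∂ρ := by
  have hres : ∀ F : ℝ → ℝ, ∫ z, g z * F z = ∫ z in Icc (-R) R, g z * F z := by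
    intro F
    refine (setIntegral_eq_integral_of_forall_compl_eq_zero fun z hz => ?_).symm
    have : g z = 0 := by
      by_contra h'
      exact hz (hR z h')
    simp [this]
  have hcs : HasCompactSupport g :=
    HasCompactSupport.intro (isCompact_Icc (a := -R) (b := R)) fun z hz => by
      by_contra h'
      exact hz (hR z h')
  have hgi : Integrable g := hg.integrable_of_hasCompactSupport hcs
  have hprod : Integrable (Function.uncurry fun (ω : Ω) (z : ℝ) => g z * crossing (a ω) (b ω) z)
      (ρ.prod (volume.restrict (Icc (-R) R))) := by
    refine (h.integrable_crossing hR1).bdd_mul (c := M)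
      (hg.comp_aestronglyMeasurable measurable_snd.aestronglyMeasurable)
      (ae_of_all _ fun p => hM p.2)
  simp_rw [intervalIntegral_eq_integral_mul_crossing hgi, hres]
  rw [integral_integral_swap hprod]
  simp_rw [integral_const_mul]

lemma tendsto_integral_intervalIntegral (h : ControlledJumps ρ a b w) {g : ℕ → ℝ → ℝ}
    (hg : ∀ n, Continuous (g n)) {M : ℝ} {R : ℕ → ℝ} (hR1 : ∀ n, 1 ≤ R n)
    (hRtop : Tendsto R atTop atTop) (hM : ∀ n z, |g n z| ≤ M / R n)
    (hR : ∀ n z, g n z ≠ 0 → z ∈ Icc (R n) (2 * R n)) :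
    Tendsto (fun n => ∫ ω, (∫ z in a ω..b ω, g n z) ∂ρ) atTop (nhds 0) := by
  rw [← integral_zero Ω ℝ (μ := ρ)]
  refine tendsto_integral_of_dominated_convergence (fun ω => 2 * M * w ω)
    (fun n => (h.measurable_intervalIntegral (hg n)).aestronglyMeasurable)
    (h.integrable_weight.const_mul _) (fun n => ae_of_all _ fun ω => ?_)
    (ae_of_all _ fun ω => ?_)
  · have hpos : 0 < R n := by linarith [hR1 n]
    have := h.abs_intervalIntegral_le (R := 2 * R n) (by linarith [hR1 n]) (hM n)
      (fun z hz => ⟨by linarith [(hR n z hz).1], (hR n z hz).2⟩) ω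
    rwa [show M / R n * (2 * R n) * w ω = 2 * M * w ω by field_simp] at this
  · refine tendsto_const_nhds.congr' ?_
    filter_upwards [hRtop.eventually_gt_atTop (max (a ω) (b ω))] with n hn
    symm
    rw [intervalIntegral.integral_congr (g := fun _ => (0 : ℝ)) fun z hz => ?_]
    · simp
    · by_contra h'
      have h1 := (hR n z h').1
      have h2 : z ≤ max (a ω) (b ω) := hz.2
      linarith

lemma integral_crossing_prod_ae_eq {μ ν : Measure ℝ} [SFinite μ] [SFinite ν]
    {a b w : ℝ × ℝ → ℝ} (h : ControlledJumps (μ.prod ν) a b w) :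
    ∀ᵐ z, ∫ p, crossing (a p) (b p) z ∂(μ.prod ν)
      = ∫ x, ∫ y, crossing (a (x, y)) (b (x, y)) z ∂ν ∂μ := by
  have hn : ∀ n : ℕ, ∀ᵐ z, z ∈ Icc (-((n : ℝ) + 1)) (n + 1) →
      Integrable (fun p => crossing (a p) (b p) z) (μ.prod ν) := by
    intro n
    rw [← ae_restrict_iff' measurableSet_Icc]
    exact (h.integrable_crossing (by linarith [n.cast_nonneg (α := ℝ)])).prod_left_ae
  filter_upwards [ae_all_iff.2 hn] with z hz
  obtain ⟨n, hn⟩ := exists_nat_ge |z|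
  exact integral_prod _ (hz n (abs_le.1 (by linarith)))

end ControlledJumps

lemma KEF.IsLevyMeasure.sFinite {ν : Measure ℝ} (hν : IsLevyMeasure ν) : SFinite ν := by
  have hm : Measurable fun y : ℝ => ENNReal.ofReal (min 1 (y ^ 2)) := by fun_prop
  have hfin : IsFiniteMeasure (ν.withDensity fun y => ENNReal.ofReal (min 1 (y ^ 2))) :=
    isFiniteMeasure_withDensity hν.2.ne
  have hpos : ∀ᵐ y ∂ν, ENNReal.ofReal (min 1 (y ^ 2)) ≠ 0 := by
    filter_upwards [compl_mem_ae_iff.2 hν.1] with y hy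
    have hy0 : y ≠ 0 := hy
    have : 0 < min 1 (y ^ 2) := lt_min one_pos (by positivity)
    exact (ENNReal.ofReal_pos.2 this).ne'
  rw [← withDensity_inv_same hm hpos (ae_of_all _ fun _ => ENNReal.ofReal_ne_top)]
  infer_instance

lemma KEF.IsLevyMeasure.integrable_min_abs {ν : Measure ℝ} (hν : IsLevyMeasure ν)
    (hFV : ∫⁻ y in Icc (-1 : ℝ) 1, ENNReal.ofReal |y| ∂ν < ⊤) :
    Integrable (fun y => min |y| 1) ν := by
  refine ⟨(by fun_prop : Measurable fun y : ℝ => min |y| 1).aestronglyMeasurable, ?_⟩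
  rw [hasFiniteIntegral_iff_ofReal (ae_of_all _ fun y => le_min (abs_nonneg y) zero_le_one),
    ← lintegral_add_compl _ (measurableSet_Icc (a := (-1 : ℝ)) (b := 1))]
  refine ENNReal.add_lt_top.2 ⟨(lintegral_mono fun y => ?_).trans_lt hFV,
    (setLIntegral_mono' (measurableSet_Icc.compl) fun y hy => ?_).trans_lt
      ((setLIntegral_le_lintegral _ _).trans_lt hν.2)⟩
  · exact ENNReal.ofReal_le_ofReal (min_le_left _ _)
  · have h1 : 1 < |y| := not_le.1 fun h => hy (abs_le.1 h)
    have h2 : 1 ≤ y ^ 2 := by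
      rw [← sq_abs]
      nlinarith
    rw [min_eq_left h2]
    exact ENNReal.ofReal_le_ofReal (min_le_right _ _)

lemma volume_real_uIoc_inter_Icc_le_abs (a b R : ℝ) :
    volume.real (uIoc a b ∩ Icc (-R) R) ≤ |b - a| := by
  refine (measureReal_mono inter_subset_left (by simp [uIoc])).trans_eq ?_
  simp [uIoc, Measure.real, abs_sub_comm, max_sub_min_eq_abs']

lemma volume_real_uIoc_inter_Icc_le (a b : ℝ) {R : ℝ} (hR : 1 ≤ R) :
    volume.real (uIoc a b ∩ Icc (-R) R) ≤ 2 * R := by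
  refine (measureReal_mono inter_subset_right (by simp)).trans_eq ?_
  rw [Real.volume_real_Icc_of_le (by linarith)]
  ring

lemma controlledJumps_add {Ω : Type*} [MeasurableSpace Ω] {ρ : Measure Ω} {X Y : Ω → ℝ}
    (hX : Measurable X) (hY : Measurable Y) (hw : Integrable (fun ω => min |Y ω| 1) ρ) :
    ControlledJumps ρ X (fun ω => X ω + Y ω) (fun ω => 4 * min |Y ω| 1) where
  measurable_left := by fun_prop
  measurable_right := by fun_prop
  integrable_weight := hw.const_mul 4
  length_le R hR ω := by
    rcases le_total |Y ω| 1 with h | h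
    · rw [min_eq_left h]
      refine (volume_real_uIoc_inter_Icc_le_abs _ _ R).trans ?_
      rw [add_sub_cancel_left]
      nlinarith [abs_nonneg (Y ω)]
    · rw [min_eq_right h]
      refine (volume_real_uIoc_inter_Icc_le _ _ hR).trans ?_
      linarith

lemma controlledJumps_mul {Ω : Type*} [MeasurableSpace Ω] {ρ : Measure Ω} {X Y : Ω → ℝ}
    (hX : Measurable X) (hY : Measurable Y) (hw : Integrable (fun ω => min |Y ω| 1) ρ) :
    ControlledJumps ρ X (fun ω => X ω + X ω * Y ω) (fun ω => 4 * min |Y ω| 1) where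
  measurable_left := by fun_prop
  measurable_right := by fun_prop
  integrable_weight := hw.const_mul 4
  length_le R hR ω := by
    generalize X ω = x, Y ω = y
    rcases le_total (1 / 2) |y| with h | h
    · refine (volume_real_uIoc_inter_Icc_le _ _ hR).trans ?_
      have : 1 / 2 ≤ min |y| 1 := le_min h (by norm_num)
      nlinarith
    · rw [min_eq_left (by linarith)]
      rcases le_or_gt |x| (2 * R) with hx | hx
      · refine (volume_real_uIoc_inter_Icc_le_abs _ _ R).trans ?_
        rw [add_sub_cancel_left, abs_mul]
        nlinarith [abs_nonneg y]
      · have hempty : uIoc x (x + x * y) ∩ Icc (-R) R = ∅ := by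
          rw [eq_empty_iff_forall_notMem]
          rintro z ⟨hz, hz1, hz2⟩
          obtain ⟨hy1, hy2⟩ := abs_le.1 h
          rcases lt_abs.1 hx with hx | hx
          · rcases mem_uIoc.1 hz with hz | hz <;> nlinarith [hz.1]
          · rcases mem_uIoc.1 hz with hz | hz <;> nlinarith [hz.2]
        rw [hempty, measureReal_empty]
        have := abs_nonneg y
        positivity

lemma integral_crossing_add (ν : Measure ℝ) (x z : ℝ) :
    ∫ y, crossing x (x + y) z ∂ν = BmapFV ν (z - x) := by
  unfold BmapFV
  rcases lt_trichotomy x z with h | h | h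
  · have : (fun y => crossing x (x + y) z) = (Ioi (z - x)).indicator 1 := by
      ext y
      have : z ∉ Ioo (x + y) x := fun h' => by linarith [h'.2]
      simp [crossing, this, indicator, h, sub_lt_iff_lt_add']
    rw [this, integral_indicator_one measurableSet_Ioi, if_pos (sub_pos.2 h)]
    rfl
  · simp [crossing, h, indicator]
  · have : (fun y => crossing x (x + y) z) = fun y => -(Iio (z - x)).indicator 1 y := by
      ext y
      have : z ∉ Ioo x (x + y) := fun h' => by linarith [h'.1]
      simp [crossing, this, indicator, h, lt_sub_iff_add_lt']
    rw [this, integral_neg, integral_indicator_one measurableSet_Iio, if_neg (by linarith),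
      if_pos (sub_neg.2 h)]
    rfl

lemma crossing_neg (a b z : ℝ) : crossing (-a) (-b) (-z) = -crossing a b z := by
  simp [crossing, indicator, and_comm]

lemma integral_crossing_mul_of_pos {ν : Measure ℝ} (hν : ν (Iio (-1)) = 0) {x : ℝ} (hx : 0 < x)
    (z : ℝ) :
    ∫ y, crossing x (x + x * y) z ∂ν = if 0 < z then BUmapFV ν (z / x) else 0 := by
  rcases lt_trichotomy x z with h | h | h
  · have : (fun y => crossing x (x + x * y) z) = (Ioi (z / x - 1)).indicator 1 := by
      ext y
      have h1 : z ∉ Ioo (x + x * y) x := fun h' => by linarith [h'.2]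
      have h2 : z < x + x * y ↔ z / x < y + 1 := by
        rw [div_lt_iff₀ hx]
        ring_nf
      simp [crossing, h1, h2, indicator, h, sub_lt_iff_lt_add]
    have hd : 1 < z / x := (one_lt_div hx).2 h
    rw [this, integral_indicator_one measurableSet_Ioi, if_pos (hx.trans h), BUmapFV,
      if_neg (by simp [hd.le]), if_pos hd]
    rfl
  · simp [crossing, ← h, indicator, hx, BUmapFV, hx.ne']
  · have : (fun y => crossing x (x + x * y) z) = fun y => -(Iio (z / x - 1)).indicator 1 y := by
      ext y
      have h1 : z ∉ Ioo x (x + x * y) := fun h' => by linarith [h'.1]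
      have h2 : x + x * y < z ↔ y + 1 < z / x := by
        rw [lt_div_iff₀ hx]
        ring_nf
      simp [crossing, h1, h2, indicator, h, lt_sub_iff_add_lt]
    have hd : z / x < 1 := (div_lt_one hx).2 h
    rw [this, integral_neg, integral_indicator_one measurableSet_Iio]
    split_ifs with hz
    · rw [BUmapFV, if_pos ⟨by positivity, hd⟩]
      rfl
    · have hz' : z / x ≤ 0 := div_nonpos_of_nonpos_of_nonneg (not_lt.1 hz) hx.le
      have : ν (Iio (z / x - 1)) = 0 := measure_mono_null (Iio_subset_Iio (by linarith)) hν
      simp [Measure.real, this]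

lemma integral_crossing_mul_of_neg {ν : Measure ℝ} (hν : ν (Iio (-1)) = 0) {x : ℝ} (hx : x < 0)
    (z : ℝ) :
    ∫ y, crossing x (x + x * y) z ∂ν = -if z < 0 then BUmapFV ν (z / x) else 0 := by
  have := integral_crossing_mul_of_pos hν (neg_pos.2 hx) (-z)
  simp only [neg_div_neg_eq, neg_pos] at this
  rw [← this, ← integral_neg]
  congr 1 with y
  rw [← neg_eq_iff_eq_neg, ← crossing_neg]
  ring_nf

lemma integral_integral_crossing_mul {μ ν : Measure ℝ}
    (hν : ν (Iio (-1)) = 0) (z : ℝ) :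
    ∫ x, ∫ y, crossing x (x + x * y) z ∂ν ∂μ = kFV ν μ z := by
  have key : (fun x => ∫ y, crossing x (x + x * y) z ∂ν)
      = fun x => (if 0 < z then (Ioi 0).indicator (fun x => BUmapFV ν (z / x)) x else 0)
        - if z < 0 then (Iio 0).indicator (fun x => BUmapFV ν (z / x)) x else 0 := by
    ext x
    rcases lt_trichotomy x 0 with hx | rfl | hx
    · simp [integral_crossing_mul_of_neg hν hx, hx, hx.not_gt]
    · simp [crossing]
    · simp [integral_crossing_mul_of_pos hν hx, hx, hx.not_gt]
  rw [key, kFV]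
  rcases lt_trichotomy z 0 with hz | rfl | hz
  · simp [hz, hz.not_gt, integral_neg, integral_indicator]
  · simp
  · simp [hz, hz.not_gt, integral_indicator]

/-- A smooth compactly supported function of zero mean has a smooth compactly supported
primitive. -/
lemma exists_contDiff_primitive {u : ℝ → ℝ} (hu : ContDiff ℝ (⊤ : ℕ∞) u)
    (hs : HasCompactSupport u) (h0 : ∫ z, u z = 0) :
    ∃ f : ℝ → ℝ, ContDiff ℝ (⊤ : ℕ∞) f ∧ HasCompactSupport f ∧ deriv f = u := by
  obtain ⟨R, hR1, hR⟩ := exists_subset_Icc_neg_of_isCompact hs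
  have hzero : ∀ z ∉ Icc (-R) R, u z = 0 := fun z hz => by
    by_contra h
    exact hz (hR (subset_closure h))
  have hd : ∀ x, HasDerivAt (fun x => ∫ z in -R..x, u z) (u x) x := fun x =>
    hu.continuous.integral_hasStrictDerivAt (-R) x |>.hasDerivAt
  have hderiv : deriv (fun x => ∫ z in -R..x, u z) = u := funext fun x => (hd x).deriv
  refine ⟨fun x => ∫ z in -R..x, u z, ?_, ?_, hderiv⟩
  · rw [contDiff_infty_iff_deriv, hderiv]
    exact ⟨fun x => (hd x).differentiableAt, hu⟩
  · refine HasCompactSupport.intro (isCompact_Icc (a := -R) (b := R)) fun x hx => ?_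
    rcases lt_or_ge x (-R) with h | h
    · rw [intervalIntegral.integral_symm, neg_eq_zero,
        intervalIntegral.integral_of_le h.le, integral_Ioc_eq_integral_Ioo]
      exact setIntegral_eq_zero_of_forall_eq_zero fun z hz => hzero z fun h' => by
        linarith [h'.1, hz.2]
    · have h2 : R < x := not_le.1 fun h' => hx ⟨h, h'⟩
      rw [intervalIntegral.integral_of_le h, ← integral_Icc_eq_integral_Ioc,
        setIntegral_eq_integral_of_forall_compl_eq_zero, h0]
      exact fun z hz => hzero z fun h' => hz ⟨h'.1, h'.2.trans h2.le⟩

/-- Smooth functions of unit mass that spread out over `[n + 1, 2 * (n + 1)]`. -/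
lemma exists_spreading_seq : ∃ (h : ℕ → ℝ → ℝ) (M : ℝ), ∀ n,
    ContDiff ℝ (⊤ : ℕ∞) (h n) ∧ (∀ z, |h n z| ≤ M / ((n : ℝ) + 1)) ∧
      (∀ z, h n z ≠ 0 → z ∈ Icc ((n : ℝ) + 1) (2 * ((n : ℝ) + 1))) ∧ ∫ z, h n z = 1 := by
  let φ : ContDiffBump (3 / 2 : ℝ) := ⟨1 / 4, 1 / 2, by norm_num, by norm_num⟩
  have hc : Continuous (φ.normed volume) := φ.continuous_normed
  obtain ⟨M, hM⟩ := hc.bounded_above_of_compact_support φ.hasCompactSupport_normed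
  refine ⟨fun n z => ((n : ℝ) + 1)⁻¹ * φ.normed volume (z / ((n : ℝ) + 1)), M, fun n => ?_⟩
  have hn : (0 : ℝ) < (n : ℝ) + 1 := by positivity
  refine ⟨?_, fun z => ?_, fun z hz => ?_, ?_⟩
  · exact contDiff_const.mul (φ.contDiff_normed.comp (contDiff_id.div_const _))
  · rw [abs_mul, abs_of_pos (inv_pos.2 hn), div_eq_inv_mul M]
    exact mul_le_mul_of_nonneg_left (hM _) (inv_pos.2 hn).le
  · have h1 : z / ((n : ℝ) + 1) ∈ Function.support (φ.normed volume) := right_ne_zero_of_mul hz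
    rw [φ.support_normed_eq, Real.ball_eq_Ioo] at h1
    have h2 : (1 : ℝ) < z / (n + 1) := lt_of_eq_of_lt (by norm_num [φ]) h1.1
    have h3 : z / (n + 1) < (2 : ℝ) := lt_of_lt_of_eq h1.2 (by norm_num [φ])
    rw [lt_div_iff₀ hn] at h2
    rw [div_lt_iff₀ hn] at h3
    exact ⟨by linarith, h3.le⟩
  · rw [integral_const_mul, Measure.integral_comp_div (φ.normed volume), φ.integral_normed,
      abs_of_pos hn, smul_eq_mul, mul_one, inv_mul_cancel₀ hn.ne']

lemma integral_sub_compensator {ν : Measure ℝ} {D : ℝ → ℝ} (hD : Integrable D ν)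
    (hFV : IntegrableOn (fun y => y) (Icc (-1 : ℝ) 1) ν) (c : ℝ) :
    ∫ y, (D y - if |y| ≤ 1 then y * c else 0) ∂ν
      = (∫ y, D y ∂ν) - (∫ y in Icc (-1 : ℝ) 1, y ∂ν) * c := by
  have heq : (fun y : ℝ => if |y| ≤ 1 then y * c else 0)
      = (Icc (-1 : ℝ) 1).indicator fun y => y * c := by
    ext y
    simp only [indicator, mem_Icc, abs_le]
  have hi : Integrable (fun y : ℝ => if |y| ≤ 1 then y * c else 0) ν := by
    rw [heq]
    exact IntegrableOn.integrable_indicator (hFV.mul_const c) measurableSet_Icc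
  rw [integral_sub hD hi, heq, integral_indicator measurableSet_Icc, integral_mul_const]

lemma integrableOn_id_of_lintegral_lt_top {ν : Measure ℝ}
    (hFV : ∫⁻ y in Icc (-1 : ℝ) 1, ENNReal.ofReal |y| ∂ν < ⊤) :
    IntegrableOn (fun y => y) (Icc (-1 : ℝ) 1) ν :=
  ⟨measurable_id.aestronglyMeasurable, by
    simpa only [hasFiniteIntegral_iff_norm, Real.norm_eq_abs] using hFV⟩

/-- In the finite variation case, the generator is a drift plus uncompensated jumps, here
written as integrals of the derivative. -/
lemma levyGen_eq_of_finiteVariation {γη γU : ℝ} {νη νU : Measure ℝ}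
    (hwη : Integrable (fun y => min |y| 1) νη) (hwU : Integrable (fun y => min |y| 1) νU)
    (hFVη : IntegrableOn (fun y => y) (Icc (-1 : ℝ) 1) νη)
    (hFVU : IntegrableOn (fun y => y) (Icc (-1 : ℝ) 1) νU)
    (hconc : νU (Iio (-1 : ℝ)) = 0) {f : ℝ → ℝ} (hf : ContDiff ℝ (⊤ : ℕ∞) f)
    {M R : ℝ} (hR1 : 1 ≤ R) (hM : ∀ z, |deriv f z| ≤ M)
    (hR : ∀ z, deriv f z ≠ 0 → z ∈ Icc (-R) R) (x : ℝ) :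
    levyGen 0 γη 0 γU νη νU f x
      = deriv f x * ((γη - ∫ y in Icc (-1 : ℝ) 1, y ∂νη)
          + x * (γU - ∫ y in Icc (-1 : ℝ) 1, y ∂νU))
        + (∫ y, (∫ z in x..x + y, deriv f z) ∂νη)
        + ∫ y, (∫ z in x..x + x * y, deriv f z) ∂νU := by
  have hcont : Continuous (deriv f) := hf.continuous_deriv (by simp)
  have hFTC : ∀ t, f t - f x = ∫ z in x..t, deriv f z := fun t =>
    (intervalIntegral.integral_deriv_eq_sub
      (fun z _ => (hf.differentiable (by simp)).differentiableAt)
      (hcont.intervalIntegrable _ _)).symm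
  have hrestr : νU.restrict (Ici (-1)) = νU := by
    refine Measure.restrict_eq_self_of_ae_mem ?_
    filter_upwards [compl_mem_ae_iff.2 hconc] with y hy
    simpa using hy
  have hη := (controlledJumps_add (X := fun _ => x) measurable_const measurable_id
    hwη).integrable_intervalIntegral hcont hR1 hM hR
  have hU := (controlledJumps_mul (X := fun _ => x) measurable_const measurable_id
    hwU).integrable_intervalIntegral hcont hR1 hM hR
  have hmul : ∀ y, x * y * deriv f x = y * (x * deriv f x) := fun y => by ring
  simp only [id] at hη hU
  simp only [levyGen, hFTC, hrestr, hmul]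
  rw [integral_sub_compensator hη hFVη, integral_sub_compensator hU hFVU]
  ring

/-- The candidate measure, tested against `g`. -/
def testFunctional (c d : ℝ) (νη νU μ : Measure ℝ) (g : ℝ → ℝ) : ℝ :=
  (∫ z, g z * (c + z * d) ∂μ)
    + (∫ p, (∫ z in p.1..p.1 + p.2, g z) ∂(μ.prod νη))
    + ∫ p, (∫ z in p.1..p.1 + p.1 * p.2, g z) ∂(μ.prod νU)

section testFunctional

variable {c d : ℝ} {νη νU μ : Measure ℝ} [IsProbabilityMeasure μ] [SFinite νη] [SFinite νU]

lemma controlledJumps_prod_add {ν : Measure ℝ} [SFinite ν]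
    (hw : Integrable (fun y => min |y| 1) ν) :
    ControlledJumps (μ.prod ν) (fun p => p.1) (fun p => p.1 + p.2) (fun p => 4 * min |p.2| 1) :=
  controlledJumps_add measurable_fst measurable_snd (hw.comp_snd μ)

lemma controlledJumps_prod_mul {ν : Measure ℝ} [SFinite ν]
    (hw : Integrable (fun y => min |y| 1) ν) :
    ControlledJumps (μ.prod ν) (fun p => p.1) (fun p => p.1 + p.1 * p.2)
      (fun p => 4 * min |p.2| 1) :=
  controlledJumps_mul measurable_fst measurable_snd (hw.comp_snd μ)

lemma abs_mul_drift_le {g : ℝ → ℝ} {M R : ℝ} (hR1 : 1 ≤ R) (hM : ∀ z, |g z| ≤ M)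
    (hR : ∀ z, g z ≠ 0 → z ∈ Icc (-R) R) (c d z : ℝ) :
    |g z * (c + z * d)| ≤ M * (R * (|c| + |d|)) := by
  have hM0 : 0 ≤ M := (abs_nonneg _).trans (hM 0)
  by_cases hz : g z = 0
  · rw [hz, zero_mul, abs_zero]
    positivity
  · have hz' : |z| ≤ R := abs_le.2 (hR z hz)
    rw [abs_mul]
    refine mul_le_mul (hM z) ((abs_add_le _ _).trans ?_) (abs_nonneg _) hM0
    rw [abs_mul]
    nlinarith [abs_nonneg c, abs_nonneg d, abs_nonneg z]

lemma integrable_mul_drift {g : ℝ → ℝ} (hg : Continuous g) {M R : ℝ} (hR1 : 1 ≤ R)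
    (hM : ∀ z, |g z| ≤ M) (hR : ∀ z, g z ≠ 0 → z ∈ Icc (-R) R) :
    Integrable (fun z => g z * (c + z * d)) μ :=
  (integrable_const (M * (R * (|c| + |d|)))).mono'
    (by fun_prop : Continuous fun z => g z * (c + z * d)).aestronglyMeasurable
    (ae_of_all _ (abs_mul_drift_le hR1 hM hR c d))

lemma abs_testFunctional_le (hwη : Integrable (fun y => min |y| 1) νη)
    (hwU : Integrable (fun y => min |y| 1) νU) {R : ℝ} (hR1 : 1 ≤ R) :
    ∃ C : ℝ, 0 ≤ C ∧ ∀ (M : ℝ) (g : ℝ → ℝ), (∀ z, |g z| ≤ M) →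
      (∀ z, g z ≠ 0 → z ∈ Icc (-R) R) → |testFunctional c d νη νU μ g| ≤ M * C := by
  refine ⟨R * (|c| + |d|) + R * (∫ p, 4 * min |p.2| 1 ∂(μ.prod νη))
    + R * (∫ p, 4 * min |p.2| 1 ∂(μ.prod νU)), ?_, fun M g hM hR => ?_⟩
  · have : ∀ ν : Measure ℝ, 0 ≤ ∫ p, 4 * min |p.2| 1 ∂(μ.prod ν) := fun ν =>
      integral_nonneg fun p => by positivity
    have h1 := this νη
    have h2 := this νU
    positivity
  · have h1 : |∫ z, g z * (c + z * d) ∂μ| ≤ M * (R * (|c| + |d|)) := by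
      simpa using norm_integral_le_of_norm_le_const (μ := μ) (f := fun z => g z * (c + z * d))
        (ae_of_all _ (abs_mul_drift_le hR1 hM hR c d))
    have h2 := (controlledJumps_prod_add (μ := μ) hwη).abs_integral_intervalIntegral_le hR1 hM hR
    have h3 := (controlledJumps_prod_mul (μ := μ) hwU).abs_integral_intervalIntegral_le hR1 hM hR
    rw [mul_add, mul_add]
    exact (abs_add_le _ _).trans (add_le_add ((abs_add_le _ _).trans (add_le_add h1 h2)) h3)

lemma testFunctional_sub_const_mul (hwη : Integrable (fun y => min |y| 1) νη)
    (hwU : Integrable (fun y => min |y| 1) νU) {g h : ℝ → ℝ} (hg : Continuous g)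
    (hh : Continuous h) (hgs : HasCompactSupport g) (hhs : HasCompactSupport h) (k : ℝ) :
    testFunctional c d νη νU μ (fun z => g z - k * h z)
      = testFunctional c d νη νU μ g - k * testFunctional c d νη νU μ h := by
  obtain ⟨M, hM⟩ := hg.bounded_above_of_compact_support hgs
  obtain ⟨N, hN⟩ := hh.bounded_above_of_compact_support hhs
  obtain ⟨R, hR1, hR⟩ := exists_subset_Icc_neg_of_isCompact hgs
  obtain ⟨S, hS1, hS⟩ := exists_subset_Icc_neg_of_isCompact hhs
  have hR' : ∀ z, g z ≠ 0 → z ∈ Icc (-R) R := fun z hz => hR (subset_closure hz)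
  have hS' : ∀ z, h z ≠ 0 → z ∈ Icc (-S) S := fun z hz => hS (subset_closure hz)
  have hη := controlledJumps_prod_add (μ := μ) hwη
  have hU := controlledJumps_prod_mul (μ := μ) hwU
  have hint : ∀ s t : ℝ, ∫ z in s..t, (g z - k * h z)
      = (∫ z in s..t, g z) - k * ∫ z in s..t, h z := fun s t => by
    rw [intervalIntegral.integral_sub (hg.intervalIntegrable _ _)
      ((hh.intervalIntegrable _ _).const_mul k), intervalIntegral.integral_const_mul]
  simp only [testFunctional, hint, sub_mul, mul_assoc]
  rw [integral_sub (integrable_mul_drift hg hR1 hM hR')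
      ((integrable_mul_drift hh hS1 hN hS').const_mul k),
    integral_sub (hη.integrable_intervalIntegral hg hR1 hM hR')
      ((hη.integrable_intervalIntegral hh hS1 hN hS').const_mul k),
    integral_sub (hU.integrable_intervalIntegral hg hR1 hM hR')
      ((hU.integrable_intervalIntegral hh hS1 hN hS').const_mul k),
    integral_const_mul, integral_const_mul, integral_const_mul]
  ring

lemma tendsto_testFunctional_spreading (hwη : Integrable (fun y => min |y| 1) νη)
    (hwU : Integrable (fun y => min |y| 1) νU) {h : ℕ → ℝ → ℝ} {M : ℝ}
    (hh : ∀ n, Continuous (h n)) (hM : ∀ n z, |h n z| ≤ M / ((n : ℝ) + 1))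
    (hR : ∀ n z, h n z ≠ 0 → z ∈ Icc ((n : ℝ) + 1) (2 * ((n : ℝ) + 1))) :
    Tendsto (fun n => testFunctional c d νη νU μ (h n)) atTop (nhds 0) := by
  have hR1 : ∀ n : ℕ, (1 : ℝ) ≤ (n : ℝ) + 1 := fun n => by
    linarith [n.cast_nonneg (α := ℝ)]
  have htop : Tendsto (fun n : ℕ => (n : ℝ) + 1) atTop atTop :=
    tendsto_atTop_add_const_right _ _ tendsto_natCast_atTop_atTop
  have hdrift : Tendsto (fun n => ∫ z, h n z * (c + z * d) ∂μ) atTop (nhds 0) := by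
    rw [← integral_zero ℝ ℝ (μ := μ)]
    refine tendsto_integral_of_dominated_convergence (fun _ => M * (2 * (|c| + |d|)))
      (fun n => ((hh n).mul (by fun_prop)).aestronglyMeasurable) (integrable_const _)
      (fun n => ae_of_all _ fun z => ?_) (ae_of_all _ fun z => ?_)
    · have hpos : (0 : ℝ) < (n : ℝ) + 1 := by positivity
      have := abs_mul_drift_le (R := 2 * ((n : ℝ) + 1)) (by linarith [hR1 n]) (hM n)
        (fun z hz => ⟨by linarith [(hR n z hz).1], (hR n z hz).2⟩) c d z
      rwa [show M / ((n : ℝ) + 1) * (2 * ((n : ℝ) + 1) * (|c| + |d|)) = M * (2 * (|c| + |d|)) by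
        field_simp] at this
    · refine tendsto_const_nhds.congr' ?_
      filter_upwards [htop.eventually_gt_atTop z] with n hn
      by_contra h'
      have : h n z ≠ 0 := fun h0 => h' (by simp [h0])
      exact absurd (hR n z this).1 (not_le.2 hn)
  have := (hdrift.add ((controlledJumps_prod_add (μ := μ) hwη).tendsto_integral_intervalIntegral
    hh hR1 htop hM hR)).add ((controlledJumps_prod_mul (μ := μ)
      hwU).tendsto_integral_intervalIntegral hh hR1 htop hM hR)
  simpa only [add_zero, testFunctional] using this

/-- A test functional that kills derivatives of test functions kills all test functions, because
the functions spreading out to infinity carry no mass in the limit. -/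
lemma testFunctional_eq_zero (hwη : Integrable (fun y => min |y| 1) νη)
    (hwU : Integrable (fun y => min |y| 1) νU)
    (hderiv : ∀ f : ℝ → ℝ, ContDiff ℝ (⊤ : ℕ∞) f → HasCompactSupport f →
      testFunctional c d νη νU μ (deriv f) = 0)
    {g : ℝ → ℝ} (hg : Continuous g) (hgs : HasCompactSupport g) :
    testFunctional c d νη νU μ g = 0 := by
  have hsmooth : ∀ u : ℝ → ℝ, ContDiff ℝ (⊤ : ℕ∞) u → HasCompactSupport u →
      testFunctional c d νη νU μ u = 0 := by
    intro u hu hus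
    obtain ⟨h, M, hh⟩ := exists_spreading_seq
    have hhs : ∀ n, HasCompactSupport (h n) := fun n =>
      HasCompactSupport.intro isCompact_Icc fun z hz => by
        by_contra h'
        exact hz ((hh n).2.2.1 z h')
    have hlim := (tendsto_testFunctional_spreading (c := c) (d := d) (μ := μ) hwη hwU
      (fun n => (hh n).1.continuous) (fun n => (hh n).2.1)
      (fun n => (hh n).2.2.1)).const_mul (∫ z, u z)
    rw [mul_zero] at hlim
    refine tendsto_nhds_unique (tendsto_const_nhds.congr fun n => ?_) hlim
    have hdiff : ContDiff ℝ (⊤ : ℕ∞) fun z => u z - (∫ z, u z) * h n z :=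
      hu.sub (contDiff_const.mul (hh n).1)
    have hsupp : HasCompactSupport fun z => u z - (∫ z, u z) * h n z :=
      hus.sub ((hhs n).mul_left)
    obtain ⟨f, hf, hfs, hfd⟩ := exists_contDiff_primitive hdiff hsupp (by
      rw [integral_sub (hu.continuous.integrable_of_hasCompactSupport hus)
        (((hh n).1.continuous.integrable_of_hasCompactSupport (hhs n)).const_mul _),
        integral_const_mul, (hh n).2.2.2, mul_one, sub_self])
    have h0 := hderiv f hf hfs
    rw [hfd, testFunctional_sub_const_mul hwη hwU hu.continuous (hh n).1.continuous hus
      (hhs n)] at h0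
    exact sub_eq_zero.1 h0
  obtain ⟨R, hR1, hR⟩ := exists_subset_Icc_neg_of_isCompact hgs
  obtain ⟨C, hC, hbound⟩ := abs_testFunctional_le (c := c) (d := d) (μ := μ) hwη hwU hR1
  refine abs_eq_zero.1 (le_antisymm (le_of_forall_pos_le_add fun ε hε => ?_) (abs_nonneg _))
  obtain ⟨u, hu, hdist, hsub⟩ := hg.exists_contDiff_approx ⊤
    (ε := fun _ => ε / (C + 1)) continuous_const fun _ => by positivity
  have hus : HasCompactSupport u := hgs.mono hsub
  have hzero := testFunctional_sub_const_mul (c := c) (d := d) (μ := μ) hwη hwU hg hu.continuous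
    hgs hus 1
  rw [hsmooth u hu hus, mul_zero, sub_zero] at hzero
  rw [← hzero, zero_add]
  refine (hbound (ε / (C + 1)) _ (fun z => ?_) fun z hz => ?_).trans ?_
  · rw [one_mul, abs_sub_comm]
    exact (hdist z).le
  · by_contra h'
    have h1 : g z = 0 := by
      by_contra h2
      exact h' (hR (subset_closure h2))
    have h2 : u z = 0 := by
      by_contra h2
      exact hsub h2 h1
    exact hz (by simp [h1, h2])
  · rw [div_mul_eq_mul_div, div_le_iff₀ (by positivity)]
    nlinarith

end testFunctional

theorem stmt9 (ση2 γη σU2 γU : ℝ) (νη νU : Measure ℝ)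
    (hνη : IsLevyMeasure νη) (hνU : IsLevyMeasure νU)
    (hconc : νU (Iio (-1 : ℝ)) = 0)
    (hnz : ¬(ση2 = 0 ∧ νη = 0 ∧ γη = 0))
    (μ : Measure ℝ) [IsProbabilityMeasure μ]
    (hinv : Invariant ση2 γη σU2 γU νη νU μ)
    (hση : ση2 = 0) (hσU : σU2 = 0)
    (hFVη : ∫⁻ y in Icc (-1 : ℝ) 1, ENNReal.ofReal |y| ∂νη < ⊤)
    (hFVU : ∫⁻ y in Icc (-1 : ℝ) 1, ENNReal.ofReal |y| ∂νU < ⊤)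
    (γη0 γU0 : ℝ)
    (hγη0 : γη0 = γη - ∫ y in Icc (-1 : ℝ) 1, y ∂νη)
    (hγU0 : γU0 = γU - ∫ y in Icc (-1 : ℝ) 1, y ∂νU) :
    (∀ g : ℝ → ℝ, Continuous g → HasCompactSupport g →
      0 = (∫ z, g z * (γη0 + z * γU0) ∂μ)
        + (∫ z, g z * convM (BmapFV νη) μ z)
        + ∫ z, g z * kFV νU μ z) ∧
    MeasureTheory.LocallyIntegrable (convM (BmapFV νη) μ) ∧
    MeasureTheory.LocallyIntegrable (kFV νU μ) := by
  subst hση hσU hγη0 hγU0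
  have := hνη.sFinite
  have := hνU.sFinite
  have hwη := hνη.integrable_min_abs hFVη
  have hwU := hνU.integrable_min_abs hFVU
  have hη := controlledJumps_prod_add (μ := μ) hwη
  have hU := controlledJumps_prod_mul (μ := μ) hwU
  have hηae : (fun z => ∫ p, crossing p.1 (p.1 + p.2) z ∂(μ.prod νη))
      =ᵐ[volume] convM (BmapFV νη) μ := by
    filter_upwards [hη.integral_crossing_prod_ae_eq] with z hz
    rw [hz]
    simp only [integral_crossing_add, convM]
  have hUae : (fun z => ∫ p, crossing p.1 (p.1 + p.1 * p.2) z ∂(μ.prod νU))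
      =ᵐ[volume] kFV νU μ := by
    filter_upwards [hU.integral_crossing_prod_ae_eq] with z hz
    rw [hz]
    exact integral_integral_crossing_mul hconc z
  refine ⟨fun g hg hgs => ?_, hη.locallyIntegrable_integral_crossing.congr hηae,
    hU.locallyIntegrable_integral_crossing.congr hUae⟩
  have hbounds : ∀ g : ℝ → ℝ, Continuous g → HasCompactSupport g →
      ∃ M R : ℝ, 1 ≤ R ∧ (∀ z, |g z| ≤ M) ∧ ∀ z, g z ≠ 0 → z ∈ Icc (-R) R := by
    intro g hg hgs
    obtain ⟨M, hM⟩ := hg.bounded_above_of_compact_support hgs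
    obtain ⟨R, hR1, hR⟩ := exists_subset_Icc_neg_of_isCompact hgs
    exact ⟨M, R, hR1, hM, fun z hz => hR (subset_closure hz)⟩
  obtain ⟨M, R, hR1, hM, hR⟩ := hbounds g hg hgs
  have hηg : ∫ z, g z * convM (BmapFV νη) μ z
      = ∫ p, (∫ z in p.1..p.1 + p.2, g z) ∂(μ.prod νη) := by
    rw [← hη.integral_mul_integral_crossing hg hR1 hM hR]
    exact integral_congr_ae (hηae.mono fun z hz => by simp only [← hz])
  have hUg : ∫ z, g z * kFV νU μ z
      = ∫ p, (∫ z in p.1..p.1 + p.1 * p.2, g z) ∂(μ.prod νU) := by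
    rw [← hU.integral_mul_integral_crossing hg hR1 hM hR]
    exact integral_congr_ae (hUae.mono fun z hz => by simp only [← hz])
  rw [hηg, hUg]
  refine (testFunctional_eq_zero hwη hwU (fun f hf hfs => ?_) hg hgs).symm
  have hcont : Continuous (deriv f) := hf.continuous_deriv (by simp)
  obtain ⟨M, R, hR1, hM, hR⟩ := hbounds (deriv f) hcont hfs.deriv
  have hηi := hη.integrable_intervalIntegral hcont hR1 hM hR
  have hUi := hU.integrable_intervalIntegral hcont hR1 hM hR
  rw [← hinv f hf hfs, testFunctional, integral_prod _ hηi, integral_prod _ hUi]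
  simp only [levyGen_eq_of_finiteVariation hwη hwU (integrableOn_id_of_lintegral_lt_top hFVη)
    (integrableOn_id_of_lintegral_lt_top hFVU) hconc hf hR1 hM hR]
  have hdi := integrable_mul_drift (c := γη - ∫ y in Icc (-1 : ℝ) 1, y ∂νη)
    (d := γU - ∫ y in Icc (-1 : ℝ) 1, y ∂νU) (μ := μ) hcont hR1 hM hR
  have hηx := hηi.integral_prod_left
  have hUx := hUi.integral_prod_left
  dsimp only at hηx hUx
  rw [integral_add (by exact hdi.add hηx) hUx, integral_add hdi hηx]

end
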